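/- arXiv:2605.13026 — 2 statements merged into one kernel-verified Lean document; each statement's English description precedes it below -/
import Mathlib

section
/- For all integers L ≥ 1, k ≥ 2, and 0 ≤ n with 2n < L, one has q_{L,k}(n) ≤ q_{L,k}(n+1); that is, N_k(n, L−n) / C(L,n) ≤ N_k(n+1, L−n−1) / C(L,n+1). Consequently, q_{L,k}(n) is maximized at n = L/2 when L is even, and at the two central points (L−1)/2 and (L+1)/2 when L is odd. -/
/-- A binary string (as a list of booleans) is `k`-inefficient if it contains `k`
consecutive equal entries; it is `k`-efficient otherwise. -/
def kEff (k : ℕ) (M : List Bool) : Prop :=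
  ¬ ∃ b : Bool, List.replicate k b <:+: M

/-- `Nk k a b` is the number of `k`-efficient binary strings of length `a + b`
having exactly `a` ones (and hence exactly `b` zeros). -/
noncomputable def Nk (k a b : ℕ) : ℕ :=
  Nat.card {M : Fin (a + b) → Bool //
    kEff k (List.ofFn M) ∧ (Finset.univ.filter fun i => M i = true).card = a}

/-- `q L k n = N_k(n, L-n) / C(L, n)`: the probability that a uniformly random binary
string of length `L` with exactly `n` ones is `k`-efficient. -/
noncomputable def qProb (L k n : ℕ) : ℝ :=
  (Nk k n (L - n) : ℝ) / (Nat.choose L n : ℝ)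

/-- `wordCount P a b` counts the binary words with `a` ones and `b` zeros satisfying `P`,
by recursion on the first letter. -/
noncomputable def wordCount (P : List Bool → Prop) (a b : ℕ) : ℕ :=
  open Classical in
  (if a = 0 ∧ b = 0 ∧ P [] then 1 else 0)
    + (if 0 < a then wordCount (fun l => P (true :: l)) (a - 1) b else 0)
    + (if 0 < b then wordCount (fun l => P (false :: l)) a (b - 1) else 0)
termination_by a + b

open Classical in
theorem natCard_eq_wordCount (n : ℕ) : ∀ (P : List Bool → Prop) (a b : ℕ), a + b = n →
    Nat.card {M : Fin n → Bool //
      P (List.ofFn M) ∧ (Finset.univ.filter fun i => M i = true).card = a} = wordCount P a b := by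
  have key : ∀ (n : ℕ) (P : List Bool → Prop) (a : ℕ), Nat.card {M : Fin n → Bool //
      P (List.ofFn M) ∧ (Finset.univ.filter fun i => M i = true).card = a} =
      ∑ M : Fin n → Bool, if P (List.ofFn M) ∧ (∑ i, if M i = true then 1 else 0) = a
        then 1 else 0 := by
    intro n P a
    rw [Nat.card_eq_fintype_card, Fintype.card_subtype]
    simp only [Finset.card_filter]
  simp only [key]
  have hle : ∀ (n : ℕ) (M : Fin n → Bool), (∑ i, if M i = true then 1 else 0) ≤ n := by
    intro n M
    rw [← Finset.card_filter]
    exact (Finset.card_le_univ _).trans (by simp)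
  induction n with
  | zero =>
    intro P a b h
    obtain ⟨rfl, rfl⟩ : a = 0 ∧ b = 0 := by omega
    rw [wordCount]
    simp
  | succ n ih =>
    intro P a b h
    rw [wordCount, ← (Fin.consEquiv fun _ : Fin (n + 1) => Bool).sum_comp, Fintype.sum_prod_type,
      Fintype.sum_bool]
    have hcons (x : Bool) (M : Fin n → Bool) :
        Fin.consEquiv (fun _ => Bool) (x, M) = (Fin.cons x M : Fin (n + 1) → Bool) := rfl
    simp only [hcons, List.ofFn_cons, Fin.sum_univ_succ, Fin.cons_zero, Fin.cons_succ,
      if_true, Bool.false_eq_true, if_false, zero_add]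
    rw [if_neg (by omega), zero_add]
    congr 1
    · split_ifs with ha
      · rw [← ih _ (a - 1) b (by omega)]
        refine Finset.sum_congr rfl fun M _ => ?_
        congr 2
        apply propext
        omega
      · refine Finset.sum_eq_zero fun M _ => if_neg ?_
        rintro ⟨-, h⟩
        omega
    · split_ifs with hb
      · exact ih (fun l => P (false :: l)) a (b - 1) (by omega)
      · refine Finset.sum_eq_zero fun M _ => if_neg ?_
        rintro ⟨-, h'⟩
        have := hle n M
        omega

theorem wordCount_map_not (n : ℕ) : ∀ (P : List Bool → Prop) (a b : ℕ), a + b = n →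
    wordCount (fun l => P (l.map not)) a b = wordCount P b a := by
  induction n with
  | zero =>
    intro P a b h
    obtain ⟨rfl, rfl⟩ : a = 0 ∧ b = 0 := by omega
    rw [wordCount, wordCount.eq_1 P 0 0]
    simp only [List.map_nil, lt_irrefl, if_false]
    rfl
  | succ n ih =>
    intro P a b h
    rw [wordCount, wordCount.eq_1 P b a, if_neg (by omega),
      if_neg (show ¬(b = 0 ∧ a = 0 ∧ P []) by omega), zero_add, zero_add, add_comm]
    simp only [List.map_cons, Bool.not_true, Bool.not_false]
    congr 1
    · split_ifs with hb
      · exact ih (fun l => P (true :: l)) a (b - 1) (by omega)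
      · rfl
    · split_ifs with ha
      · exact ih (fun l => P (false :: l)) (a - 1) b (by omega)
      · rfl

theorem wordCount_eq_zero (n : ℕ) : ∀ (P : List Bool → Prop) (a b : ℕ), a + b = n →
    (∀ l, ¬ P l) → wordCount P a b = 0 := by
  induction n with
  | zero =>
    intro P a b h hP
    obtain ⟨rfl, rfl⟩ : a = 0 ∧ b = 0 := by omega
    rw [wordCount]
    simp [hP]
  | succ n ih =>
    intro P a b h hP
    rw [wordCount, if_neg (by omega)]
    simp only [zero_add, Nat.add_eq_zero_iff, ite_eq_right_iff]
    exact ⟨fun ha => ih _ _ _ (by omega) fun l => hP _, fun hb => ih _ _ _ (by omega) fun l => hP _⟩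

theorem kEff_map_not {k : ℕ} {l : List Bool} : kEff k (l.map not) ↔ kEff k l := by
  have key : ∀ l : List Bool, kEff k (l.map not) → kEff k l := by
    rintro l h ⟨b, hb⟩
    exact h ⟨!b, by simpa using hb.map not⟩
  refine ⟨key l, fun h => key _ ?_⟩
  simpa [Function.comp_def] using h

theorem kEff_replicate {k m : ℕ} (hm : m < k) : kEff k (List.replicate m true) := by
  rintro ⟨b, hb⟩
  have := hb.length_le
  simp at this
  omega

theorem not_kEff_replicate_append (k : ℕ) (l : List Bool) :
    ¬ kEff k (List.replicate k true ++ l) :=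
  fun h => h ⟨true, (List.prefix_append _ _).isInfix⟩

theorem kEff_replicate_append_false {k m : ℕ} (hm : m < k) (l : List Bool) :
    kEff k (List.replicate m true ++ false :: l) ↔ kEff k (false :: l) := by
  induction m with
  | zero => simp
  | succ m ih =>
    rw [← ih (by omega)]
    unfold kEff
    refine not_congr (exists_congr fun b => ?_)
    rw [List.replicate_succ (n := m), List.cons_append, List.infix_cons_iff]
    refine or_iff_right fun h => ?_
    have h0 := h.getElem (i := 0) (by simp; omega)
    have h1 := h.getElem (i := m + 1) (by simp; omega)
    simp at h0 h1
    simp [h0] at h1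

/-- The number of `k`-efficient words with `a` ones and `b` zeros that are empty or start
with a one. -/
noncomputable def onesFirstCount (k a b : ℕ) : ℕ :=
  (if a = 0 ∧ b = 0 then 1 else 0)
    + (if 0 < a then wordCount (fun l => kEff k (true :: l)) (a - 1) b else 0)

theorem wordCount_kEff_false_cons (k a b : ℕ) :
    wordCount (fun l => kEff k (false :: l)) a b =
      wordCount (fun l => kEff k (true :: l)) b a := by
  rw [← wordCount_map_not (a + b) _ a b rfl]
  congr 1
  funext l
  rw [← kEff_map_not (l := false :: l)]
  simp

theorem wordCount_replicate_append {k m : ℕ} (hm : m < k) (a b : ℕ) :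
    wordCount (fun l => kEff k (List.replicate m true ++ l)) a b =
      onesFirstCount k b a + (if 0 < a then
        wordCount (fun l => kEff k (List.replicate (m + 1) true ++ l)) (a - 1) b else 0) := by
  rw [wordCount, onesFirstCount]
  simp only [kEff_replicate_append_false hm, wordCount_kEff_false_cons, List.append_nil,
    kEff_replicate hm, and_true, List.replicate_succ', List.append_assoc, List.singleton_append]
  rw [add_right_comm]
  simp only [and_comm]

theorem wordCount_replicate_append_eq_sum {k : ℕ} (j : ℕ) : ∀ m a b : ℕ, m + j = k →
    wordCount (fun l => kEff k (List.replicate m true ++ l)) a b =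
      ∑ i ∈ Finset.range j, if i ≤ a then onesFirstCount k b (a - i) else 0 := by
  induction j with
  | zero =>
    rintro m a b rfl
    exact wordCount_eq_zero _ _ _ _ rfl fun l => not_kEff_replicate_append m l
  | succ j ih =>
    intro m a b h
    rw [wordCount_replicate_append (by omega), Finset.sum_range_succ', add_comm,
      ih _ _ _ (by omega)]
    simp only [Nat.zero_le, if_true, Nat.sub_zero]
    congr 1
    split_ifs with ha
    · refine Finset.sum_congr rfl fun i _ => ?_
      rw [show a - 1 - i = a - (i + 1) by omega]
      exact if_congr (by omega) rfl rfl
    · exact (Finset.sum_eq_zero fun i _ => if_neg (by omega)).symm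

theorem onesFirstCount_rec {k : ℕ} (hk : 1 ≤ k) (a b : ℕ) :
    onesFirstCount k a b = (if a = 0 ∧ b = 0 then 1 else 0) +
      ∑ i ∈ Finset.range (k - 1), if i + 1 ≤ a then onesFirstCount k b (a - (i + 1)) else 0 := by
  rw [onesFirstCount]
  congr 1
  have h := wordCount_replicate_append_eq_sum (k := k) (k - 1) 1 (a - 1) b (by omega)
  simp only [List.replicate_one, List.singleton_append] at h
  rw [h]
  split_ifs with ha
  · refine Finset.sum_congr rfl fun i _ => ?_
    rw [show a - 1 - i = a - (i + 1) by omega]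
    exact if_congr (by omega) rfl rfl
  · exact (Finset.sum_eq_zero fun i _ => if_neg (by omega)).symm

theorem Nk_add_ite {k : ℕ} (hk : 1 ≤ k) (a b : ℕ) :
    Nk k a b + (if a = 0 ∧ b = 0 then 1 else 0) = onesFirstCount k a b + onesFirstCount k b a := by
  have h := wordCount_replicate_append (k := k) (m := 0) (by omega) a b
  simp only [List.replicate_zero, List.nil_append, zero_add, List.replicate_one,
    List.singleton_append] at h
  rw [Nk, natCard_eq_wordCount _ _ _ _ rfl, h, onesFirstCount.eq_1 k a b]
  omega

theorem Nk_comm {k : ℕ} (hk : 1 ≤ k) (a b : ℕ) : Nk k a b = Nk k b a := by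
  have h1 := Nk_add_ite hk a b
  have h2 := Nk_add_ite hk b a
  simp only [and_comm (a := b = 0)] at h2
  omega

/-- If `K` is antisymmetric and nonnegative above the diagonal, then so are its sums over boxes
lying above the diagonal. -/
theorem sum_box_nonneg {K : ℕ → ℕ → ℤ} (hK : ∀ u v, K u v = -K v u) {r a c : ℕ} (hac : a ≤ c)
    (hpos : ∀ u < a, ∀ v < c, u ≤ v → 0 ≤ K u v) :
    0 ≤ ∑ u ∈ Finset.Ico (a - r) a, ∑ v ∈ Finset.Ico (c - r) c, K u v := by
  have hdiag : ∑ u ∈ Finset.Ico (c - r) a, ∑ v ∈ Finset.Ico (c - r) a, K u v = 0 := by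
    have h : ∑ u ∈ Finset.Ico (c - r) a, ∑ v ∈ Finset.Ico (c - r) a, K u v =
        -∑ u ∈ Finset.Ico (c - r) a, ∑ v ∈ Finset.Ico (c - r) a, K u v := by
      conv_lhs => rw [Finset.sum_comm]
      simp only [← Finset.sum_neg_distrib]
      exact Finset.sum_congr rfl fun u _ => Finset.sum_congr rfl fun v _ => hK v u
    omega
  rw [← hdiag, ← Finset.sum_product', ← Finset.sum_product']
  refine Finset.sum_le_sum_of_subset_of_nonneg ?_ ?_
  · rintro ⟨u, v⟩ h
    simp only [Finset.mem_product, Finset.mem_Ico] at h ⊢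
    omega
  · rintro ⟨u, v⟩ h h'
    simp only [Finset.mem_product, Finset.mem_Ico] at h h'
    exact hpos u h.1.2 v h.2.2 (by omega)

theorem sum_range_ite_eq_sum_Ico (f : ℕ → ℤ) (r a : ℕ) :
    ∑ i ∈ Finset.range r, (if i + 1 ≤ a then f (a - (i + 1)) else 0) =
      ∑ u ∈ Finset.Ico (a - r) a, f u := by
  rw [← Finset.sum_filter]
  refine Finset.sum_nbij' (fun i => a - (i + 1)) (fun u => a - (u + 1)) ?_ ?_ ?_ ?_ ?_ <;>
    simp only [Finset.mem_filter, Finset.mem_range, Finset.mem_Ico]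
  all_goals first | (intros; omega) | simp

theorem antisymm_nonneg_of_box_rec {r : ℕ} {G S : ℕ → ℕ → ℤ}
    (hrec : ∀ a c, S a c = G a c +
      ∑ u ∈ Finset.Ico (a - r) a, ∑ v ∈ Finset.Ico (c - r) c, S u v)
    (hG : ∀ a c, a ≤ c → G c a ≤ G a c) : ∀ a c, a ≤ c → S c a ≤ S a c := by
  suffices h : ∀ n a c, a + c = n → a ≤ c → S c a ≤ S a c from fun a c => h _ a c rfl
  intro n
  induction n using Nat.strong_induction_on with
  | _ n ih =>
    rintro a c rfl hac
    have hbox := sum_box_nonneg (K := fun u v => S u v - S v u) (r := r) (fun u v => by ring) hac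
      fun u hu v hv huv => sub_nonneg.2 (ih (u + v) (by omega) u v rfl huv)
    simp only [Finset.sum_sub_distrib] at hbox
    rw [Finset.sum_comm (f := fun u v => S v u)] at hbox
    rw [hrec c a, hrec a c]
    linarith [hG a c hac]

open PowerSeries in
theorem coeff_coeff_box_mul (r : ℕ) (S : PowerSeries (PowerSeries ℤ)) (a c : ℕ) :
    coeff c (coeff a ((∑ i ∈ Finset.range r, X ^ (i + 1)) *
      (C (∑ j ∈ Finset.range r, X ^ (j + 1)) * S))) =
      ∑ u ∈ Finset.Ico (a - r) a, ∑ v ∈ Finset.Ico (c - r) c, coeff v (coeff u S) := by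
  have h (T : PowerSeries ℤ) : coeff c ((∑ j ∈ Finset.range r, X ^ (j + 1)) * T) =
      ∑ v ∈ Finset.Ico (c - r) c, coeff v T := by
    rw [← sum_range_ite_eq_sum_Ico, Finset.sum_mul, map_sum]
    exact Finset.sum_congr rfl fun i _ => coeff_X_pow_mul' _ _ _
  rw [← sum_range_ite_eq_sum_Ico, Finset.sum_mul, map_sum, map_sum]
  refine Finset.sum_congr rfl fun i _ => ?_
  rw [coeff_X_pow_mul', coeff_C_mul]
  split_ifs
  · exact h _
  · simp

open PowerSeries in
theorem coeff_geom_sq_nonneg (k c : ℕ) :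
    0 ≤ coeff c ((∑ j ∈ Finset.range k, (X : PowerSeries ℤ) ^ j) ^ 2) := by
  rw [sq, coeff_mul]
  refine Finset.sum_nonneg fun x _ => mul_nonneg ?_ ?_ <;>
  · rw [map_sum]
    refine Finset.sum_nonneg fun j _ => ?_
    rw [coeff_X_pow]
    split_ifs <;> simp

open PowerSeries in
theorem coeff_geom_sq {k c : ℕ} (hc : c < k) :
    coeff c ((∑ j ∈ Finset.range k, (X : PowerSeries ℤ) ^ j) ^ 2) = (c + 1 : ℤ) := by
  rw [sq, coeff_mul]
  have h (i : ℕ) (hi : i < k) : coeff i (∑ j ∈ Finset.range k, (X : PowerSeries ℤ) ^ j) = 1 := by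
    simp [coeff_X_pow, hi]
  rw [Finset.sum_congr rfl (g := fun _ => 1)]
  · simp
  · intro x hx
    rw [Finset.HasAntidiagonal.mem_antidiagonal] at hx
    rw [h _ (by omega), h _ (by omega), one_mul]

open PowerSeries in
/-- The main inequality, with denominators cleared. -/
theorem succ_mul_Nk_le {k : ℕ} (hk : 1 ≤ k) {a c : ℕ} (hac : a ≤ c) :
    (c + 1) * Nk k a (c + 1) ≤ (a + 1) * Nk k (a + 1) c := by
  obtain ⟨r, rfl⟩ : ∃ r, k = r + 1 := ⟨k - 1, by omega⟩
  let A : PowerSeries (PowerSeries ℤ) := mk fun a => mk fun b => (onesFirstCount (r + 1) a b : ℤ)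
  let B : PowerSeries (PowerSeries ℤ) := mk fun a => mk fun b => (onesFirstCount (r + 1) b a : ℤ)
  let p : PowerSeries (PowerSeries ℤ) := ∑ i ∈ Finset.range r, X ^ (i + 1)
  let q₀ : PowerSeries ℤ := ∑ i ∈ Finset.range r, X ^ (i + 1)
  let q : PowerSeries (PowerSeries ℤ) := C q₀
  have hone (a b : ℕ) : coeff b (coeff a (1 : PowerSeries (PowerSeries ℤ))) =
      if a = 0 ∧ b = 0 then 1 else 0 := by
    rw [coeff_one]
    by_cases ha : a = 0 <;> simp [ha, coeff_one]
  have hA : A = 1 + p * B := by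
    ext a b
    rw [map_add, map_add, hone]
    simp only [A, B, p, coeff_mk, Finset.sum_mul, map_sum, coeff_X_pow_mul']
    rw [onesFirstCount_rec hk a b]
    push_cast
    congr 1
    refine Finset.sum_congr rfl fun i _ => ?_
    split_ifs <;> simp
  have hB : B = 1 + q * A := by
    ext a b
    rw [map_add, map_add, hone]
    simp only [A, B, q, q₀, coeff_mk, coeff_C_mul, Finset.sum_mul, map_sum, coeff_X_pow_mul']
    rw [onesFirstCount_rec hk b a]
    push_cast
    simp only [and_comm]
  let d := PowerSeries.derivative (PowerSeries ℤ)
  have hdq : d q = 0 := PowerSeries.derivative_C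
  have hdA : d A = p * d B + B * d p := by
    conv_lhs => rw [hA]
    simp
  have hdB : d B = q * d A := by
    conv_lhs => rw [hB]
    simp [hdq]
  let R := d (A + B)
  let T := d p * (1 + q) * B
  let H := d p * (1 + q) ^ 2
  have hR : R = T + p * (q * R) := by
    simp only [R, T, map_add]
    linear_combination (1 + q) * hdA + (1 + p) * hdB
  have hT : T = H + p * (q * T) := by
    simp only [T, H]
    linear_combination d p * (1 + q) * (hB + q * hA)
  have hRcoeff (a c : ℕ) : coeff c (coeff a R) = (a + 1) * Nk (r + 1) (a + 1) c := by
    have h := Nk_add_ite hk (a + 1) c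
    rw [if_neg (by omega), add_zero] at h
    rw [show coeff a R = _ from PowerSeries.coeff_derivative _ _,
      show ((a : PowerSeries ℤ) + 1) = C ((a : ℤ) + 1) by simp, coeff_mul_C, h, mul_comm]
    simp [A, B]
  have hpq : 1 + q = C (∑ j ∈ Finset.range (r + 1), (X : PowerSeries ℤ) ^ j) := by
    simp only [q, q₀]
    rw [Finset.sum_range_succ', pow_zero, map_add, map_one, add_comm]
  have hHcoeff (a c : ℕ) : coeff c (coeff a H) = if a < r then
      ((a : ℤ) + 1) * coeff c ((∑ j ∈ Finset.range (r + 1), (X : PowerSeries ℤ) ^ j) ^ 2) else 0 := by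
    have hp : coeff (a + 1) p = if a < r then 1 else 0 := by
      simp [p, coeff_X_pow]
    simp only [H]
    rw [hpq, ← map_pow, coeff_mul_C, show coeff a (d p) = _ from PowerSeries.coeff_derivative _ _,
      hp, show ((a : PowerSeries ℤ) + 1) = C ((a : ℤ) + 1) by simp]
    split_ifs
    · rw [one_mul, coeff_C_mul]
    · simp
  have hHmono (a c : ℕ) (hac : a ≤ c) : coeff a (coeff c H) ≤ coeff c (coeff a H) := by
    rw [hHcoeff, hHcoeff]
    by_cases hc : c < r
    · rw [if_pos hc, if_pos (by omega), coeff_geom_sq (by omega), coeff_geom_sq (by omega),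
        mul_comm]
    · rw [if_neg hc]
      split_ifs
      · exact mul_nonneg (by positivity) (coeff_geom_sq_nonneg _ _)
      · rfl
  have hTmono := antisymm_nonneg_of_box_rec (r := r) (S := fun a c => coeff c (coeff a T))
    (G := fun a c => coeff c (coeff a H))
    (fun a c => by
      rw [← coeff_coeff_box_mul]
      conv_lhs => rw [hT]
      simp only [map_add]
      rfl) hHmono
  have hRmono := antisymm_nonneg_of_box_rec (r := r) (S := fun a c => coeff c (coeff a R))
    (G := fun a c => coeff c (coeff a T))
    (fun a c => by
      rw [← coeff_coeff_box_mul]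
      conv_lhs => rw [hR]
      simp only [map_add]
      rfl) hTmono
  have h := hRmono a c hac
  simp only [hRcoeff] at h
  rw [Nk_comm hk a]
  exact_mod_cast h

theorem qProb_le_succ {L k n : ℕ} (hk : 1 ≤ k) (hn : 2 * n < L) :
    qProb L k n ≤ qProb L k (n + 1) := by
  obtain ⟨c, rfl⟩ : ∃ c, L = n + c + 1 := ⟨L - n - 1, by omega⟩
  have h := succ_mul_Nk_le hk (show n ≤ c by omega)
  have hchoose := Nat.choose_succ_right_eq (n + c + 1) n
  have h1 : 0 < (n + c + 1).choose n := Nat.choose_pos (by omega)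
  have h2 : 0 < (n + c + 1).choose (n + 1) := Nat.choose_pos (by omega)
  rw [qProb, qProb, div_le_div_iff₀ (by exact_mod_cast h1) (by exact_mod_cast h2)]
  rw [show n + c + 1 - n = c + 1 by omega] at hchoose ⊢
  rw [show n + c + 1 - (n + 1) = c by omega]
  norm_cast
  refine Nat.le_of_mul_le_mul_left ?_ (Nat.succ_pos n)
  calc (n + 1) * (Nk k n (c + 1) * (n + c + 1).choose (n + 1))
      = ((c + 1) * Nk k n (c + 1)) * (n + c + 1).choose n := by
        linear_combination Nk k n (c + 1) * hchoose
    _ ≤ ((n + 1) * Nk k (n + 1) c) * (n + c + 1).choose n := Nat.mul_le_mul_right _ h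
    _ = (n + 1) * (Nk k (n + 1) c * (n + c + 1).choose n) := by ring

theorem qProb_symm {L k m : ℕ} (hk : 1 ≤ k) (hm : m ≤ L) : qProb L k (L - m) = qProb L k m := by
  rw [qProb, qProb, Nat.choose_symm hm, Nk_comm hk, Nat.sub_sub_self hm]

theorem qProb_le_half {L k m : ℕ} (hk : 1 ≤ k) (hm : m ≤ L) : qProb L k m ≤ qProb L k (L / 2) := by
  have key (m : ℕ) (hm : m ≤ L / 2) : qProb L k m ≤ qProb L k (L / 2) := by
    induction hm using Nat.decreasingInduction with
    | self => rfl
    | of_succ j hj ih => exact (qProb_le_succ hk (by omega)).trans ih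
  rcases le_or_gt m (L / 2) with h | h
  · exact key m h
  · rw [← qProb_symm hk hm]
    exact key _ (by omega)

/-- Central monotonicity of `q_{L,k}`: for `2n < L` one has `q_{L,k}(n) ≤ q_{L,k}(n+1)`.
Consequently `q_{L,k}` is maximized at `n = L/2` when `L` is even, and at the two central
points `(L-1)/2` and `(L+1)/2` (where it takes equal values) when `L` is odd. -/
theorem qProb_central_monotone (L k : ℕ) (hL : 1 ≤ L) (hk : 2 ≤ k) :
    (∀ n : ℕ, 2 * n < L → qProb L k n ≤ qProb L k (n + 1)) ∧
    (L % 2 = 0 → ∀ m ≤ L, qProb L k m ≤ qProb L k (L / 2)) ∧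
    (L % 2 = 1 →
      (qProb L k ((L - 1) / 2) = qProb L k ((L + 1) / 2) ∧
        ∀ m ≤ L, qProb L k m ≤ qProb L k ((L - 1) / 2))) := by
  have hk' : 1 ≤ k := by omega
  refine ⟨fun n hn => qProb_le_succ hk' hn, fun _ m hm => qProb_le_half hk' hm, fun hodd => ?_⟩
  rw [show (L - 1) / 2 = L / 2 by omega, show (L + 1) / 2 = L - L / 2 by omega]
  exact ⟨(qProb_symm hk' (by omega)).symm, fun m hm => qProb_le_half hk' hm⟩
end

section
/- For all integers k ≥ 2 and 0 ≤ n < m, one has (n+1)·N_k(n+1, m−1) − m·N_k(n, m) ≥ 0. -/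
open Polynomial

namespace EfficientStrings

/-! ### Recursive structure of efficient strings -/

theorem kEff_replicate_append_cons_not {k j : ℕ} (hjk : j < k) (b : Bool) (M : List Bool) :
    kEff k (List.replicate j b ++ (!b) :: M) ↔ kEff k ((!b) :: M) := by
  induction j with
  | zero => simp
  | succ j ih =>
    rw [← ih (by omega)]
    simp only [kEff, List.replicate_succ, List.cons_append, List.infix_cons_iff (a := b)]
    refine not_congr (exists_congr fun c => or_iff_right ?_)
    rintro ⟨t, ht⟩
    have h₀ := congrArg (fun l => l[0]?) ht
    have h₁ := congrArg (fun l => l[j + 1]?) ht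
    simp only [List.getElem?_append, List.length_replicate, List.getElem?_replicate,
      List.getElem?_cons_succ, List.getElem?_cons_zero, hjk, if_true,
      Nat.lt_irrefl, if_false, Nat.sub_self, (by omega : 0 < k), Option.some.injEq] at h₀ h₁
    subst h₀
    simp at h₁

theorem not_kEff_replicate_append (k : ℕ) (b : Bool) (M : List Bool) :
    ¬ kEff k (List.replicate k b ++ M) :=
  fun h => h ⟨b, (List.prefix_append _ _).isInfix⟩

theorem kEff_replicate {k j : ℕ} (hjk : j < k) (b : Bool) : kEff k (List.replicate j b) := by
  rintro ⟨c, hc⟩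
  have := hc.length_le
  simp only [List.length_replicate] at this
  omega

theorem ncard_eq_add_cons {S : Set (List Bool)} (hS : S.Finite) (b : Bool) :
    S.ncard = ({M | M = [] ∧ M ∈ S}).ncard + {M | b :: M ∈ S}.ncard
      + {M | (!b) :: M ∈ S}.ncard := by
  have hfin : ∀ c : Bool, (List.cons c '' {M | c :: M ∈ S}).Finite := fun c =>
    hS.subset (by rintro _ ⟨M, hM, rfl⟩; exact hM)
  have hnil : ({M | M = [] ∧ M ∈ S}).Finite := hS.subset fun M hM => hM.2
  have hdecomp : S = ({M | M = [] ∧ M ∈ S} ∪ List.cons b '' {M | b :: M ∈ S})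
      ∪ List.cons (!b) '' {M | (!b) :: M ∈ S} := by
    ext M
    rcases M with _ | ⟨c, M⟩
    · simp
    · cases b <;> cases c <;> simp
  conv_lhs => rw [hdecomp]
  rw [Set.ncard_union_eq _ (hnil.union (hfin b)) (hfin _),
    Set.ncard_union_eq _ hnil (hfin b),
    Set.ncard_image_of_injective _ List.cons_injective,
    Set.ncard_image_of_injective _ List.cons_injective]
  · rw [Set.disjoint_left]
    rintro _ ⟨rfl, -⟩ ⟨M, -, h⟩
    simp at h
  · rw [Set.disjoint_left]
    rintro _ (⟨rfl, -⟩ | ⟨M, -, rfl⟩) ⟨M', -, h⟩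
    · simp at h
    · cases b <;> simp at h

/-- The strings with `c` entries `b` and `d` entries `!b` that remain `k`-efficient when they are
preceded by `j` further entries `b`. -/
def efficientExtensions (k : ℕ) (b : Bool) (j c d : ℕ) : Set (List Bool) :=
  {M | kEff k (List.replicate j b ++ M) ∧ M.count b = c ∧ M.count (!b) = d}

theorem finite_efficientExtensions (k : ℕ) (b : Bool) (j c d : ℕ) :
    (efficientExtensions k b j c d).Finite := by
  refine (List.finite_length_eq Bool (c + d)).subset ?_
  rintro M ⟨-, hc, hd⟩
  have := List.count_not_add_count M b
  simp only [Set.mem_ofPred_eq]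
  omega

theorem efficientExtensions_self (k : ℕ) (b : Bool) (c d : ℕ) :
    efficientExtensions k b k c d = ∅ := by
  ext M
  simp [efficientExtensions, not_kEff_replicate_append]

theorem ncard_efficientExtensions {k j : ℕ} (hjk : j < k) (b : Bool) (c d : ℕ) :
    (efficientExtensions k b j c d).ncard = (if c = 0 ∧ d = 0 then 1 else 0)
      + (if c = 0 then 0 else (efficientExtensions k b (j + 1) (c - 1) d).ncard)
      + (if d = 0 then 0 else (efficientExtensions k (!b) 1 (d - 1) c).ncard) := by
  rw [ncard_eq_add_cons (finite_efficientExtensions k b j c d) b]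
  congr 1
  · congr 1
    · split_ifs with h
      · obtain ⟨rfl, rfl⟩ := h
        rw [Set.ncard_eq_one]
        refine ⟨[], ?_⟩
        ext M
        simp only [efficientExtensions, Set.mem_ofPred_eq, Set.mem_singleton_iff, and_iff_left_iff_imp]
        rintro rfl
        simpa using kEff_replicate hjk b
      · convert Set.ncard_empty (List Bool)
        ext M
        simp only [efficientExtensions, Set.mem_ofPred_eq, Set.mem_empty_iff_false, iff_false]
        rintro ⟨rfl, -, rfl, rfl⟩
        simp at h
    · split_ifs with h
      · convert Set.ncard_empty (List Bool)
        ext M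
        simp [efficientExtensions, h]
      · congr 1
        ext M
        simp only [efficientExtensions, Set.mem_ofPred_eq, List.replicate_succ', List.append_assoc,
          List.cons_append, List.nil_append, List.count_cons_self]
        have : List.count (!b) (b :: M) = List.count (!b) M := by cases b <;> simp
        rw [this, show (List.count b M + 1 = c ↔ List.count b M = c - 1) by omega]
  · split_ifs with h
    · convert Set.ncard_empty (List Bool)
      ext M
      simp [efficientExtensions, h]
    · congr 1
      ext M
      have : List.count b ((!b) :: M) = List.count b M := by cases b <;> simp
      simp only [efficientExtensions, Set.mem_ofPred_eq, kEff_replicate_append_cons_not hjk,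
        List.count_cons_self, this, List.replicate_one, List.cons_append, List.nil_append,
        Bool.not_not, show (List.count (!b) M + 1 = d ↔ List.count (!b) M = d - 1) by omega]
      tauto

theorem Nk_eq_ncard (k a b : ℕ) : Nk k a b = (efficientExtensions k true 0 a b).ncard := by
  have hcount : ∀ M : Fin (a + b) → Bool,
      (Finset.univ.filter fun i => M i = true).card = (List.ofFn M).count true := by
    intro M
    have := Fin.card_filter_univ_eq_vector_get_eq_count true (List.Vector.ofFn M)
    simpa using this
  rw [Nk, ← Nat.card_coe_set_eq]
  refine Nat.card_congr (Equiv.ofBijective (fun M => ⟨List.ofFn M.1, ?_⟩) ⟨?_, ?_⟩)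
  · obtain ⟨M, hM, h⟩ := M
    rw [hcount] at h
    have := List.count_true_add_count_false (List.ofFn M)
    rw [List.length_ofFn] at this
    exact ⟨by simpa using hM, h, by simp only [Bool.not_true]; omega⟩
  · intro M M' h
    exact Subtype.ext (List.ofFn_injective (congrArg Subtype.val h))
  · rintro ⟨l, hl, ha, hb⟩
    have hlen : l.length = a + b := by
      have := List.count_true_add_count_false l
      simp only [Bool.not_true] at hb
      omega
    have hofFn : List.ofFn (fun i : Fin (a + b) => l.get (i.cast hlen.symm)) = l := by
      apply List.ext_getElem <;> simp [hlen]
    refine ⟨⟨fun i => l.get (i.cast hlen.symm), ?_, ?_⟩, Subtype.ext hofFn⟩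
    · rw [hofFn]
      simpa using hl
    · rw [hcount, hofFn, ha]

/-! ### Generating polynomials -/

/-- The polynomial `1 + X + ⋯ + X ^ (s - 1)`. -/
noncomputable def geomPoly (s : ℕ) : ℤ[X] := ∑ i ∈ Finset.range s, X ^ i

theorem coeff_geomPoly (s i : ℕ) : (geomPoly s).coeff i = if i < s then 1 else 0 := by
  simp [geomPoly, coeff_X_pow]

theorem geomPoly_succ (s : ℕ) : geomPoly (s + 1) = X * geomPoly s + 1 := by
  simp [geomPoly, Finset.sum_range_succ', Finset.mul_sum, pow_succ']

/-- The generating polynomial of the lengths of a run in a `k`-efficient string. -/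
noncomputable def runPoly (k : ℕ) : ℤ[X] := X * geomPoly (k - 1)

theorem geomPoly_eq_runPoly_add_one {k : ℕ} (hk : 0 < k) : geomPoly k = runPoly k + 1 := by
  obtain ⟨k, rfl⟩ := Nat.exists_eq_succ_of_ne_zero hk.ne'
  simp [runPoly, geomPoly_succ]

theorem coeff_runPoly_pow_of_lt {k p n : ℕ} (h : n < p) : ((runPoly k) ^ p).coeff n = 0 := by
  rw [runPoly, mul_pow, coeff_X_pow_mul', if_neg (by omega)]

theorem coeff_mul_runPoly_pow_of_lt (Q : ℤ[X]) {k p n : ℕ} (h : n < p) :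
    (Q * (runPoly k) ^ p).coeff n = 0 := by
  rw [runPoly, mul_pow, mul_left_comm, coeff_X_pow_mul', if_neg (by omega)]

theorem coeff_X_mul_eq_ite (Q : ℤ[X]) (n : ℕ) :
    (X * Q).coeff n = if n = 0 then 0 else Q.coeff (n - 1) := by
  cases n <;> simp

theorem ncard_efficientExtensions_eq_sum {k : ℕ} (hk : 0 < k) (N : ℕ) :
    ∀ (L : ℕ) (b : Bool) (j c d : ℕ), c + d = L → L < N → j ≤ k →
      ((efficientExtensions k b j c d).ncard : ℤ) = ∑ p ∈ Finset.range N,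
        (geomPoly (k - j) * (runPoly k) ^ p).coeff c * (geomPoly k * (runPoly k) ^ p).coeff d := by
  intro L
  induction L using Nat.strong_induction_on with
  | _ L ih =>
  intro b j c d hL hN hj
  rcases hj.eq_or_lt with rfl | hj
  · simp [efficientExtensions_self, geomPoly]
  have hfst : ((if c = 0 then 0 else (efficientExtensions k b (j + 1) (c - 1) d).ncard : ℕ) : ℤ)
      = ∑ p ∈ Finset.range N, (X * (geomPoly (k - (j + 1)) * (runPoly k) ^ p)).coeff c
          * (geomPoly k * (runPoly k) ^ p).coeff d := by
    simp only [coeff_X_mul_eq_ite]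
    split_ifs with h
    · simp
    · exact ih (c - 1 + d) (by omega) b (j + 1) (c - 1) d rfl (by omega) (by omega)
  have hsnd : ((if d = 0 then 0 else (efficientExtensions k (!b) 1 (d - 1) c).ncard : ℕ) : ℤ)
      = ∑ p ∈ Finset.range N, (X * (geomPoly (k - 1) * (runPoly k) ^ p)).coeff d
          * (geomPoly k * (runPoly k) ^ p).coeff c := by
    simp only [coeff_X_mul_eq_ite]
    split_ifs with h
    · simp
    · exact ih (d - 1 + c) (by omega) (!b) 1 (d - 1) c rfl (by omega) (by omega)
  have htel := Finset.sum_range_sub'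
    (fun p => ((runPoly k) ^ p).coeff c * ((runPoly k) ^ p).coeff d) N
  rw [coeff_runPoly_pow_of_lt (by omega : c < N), zero_mul, sub_zero, pow_zero, coeff_one,
    coeff_one] at htel
  have hone : (((if c = 0 ∧ d = 0 then 1 else 0 : ℕ)) : ℤ)
      = (if c = 0 then 1 else 0) * (if d = 0 then 1 else 0) := by
    by_cases hc : c = 0 <;> by_cases hd : d = 0 <;> simp [hc, hd]
  rw [ncard_efficientExtensions hj, Nat.cast_add, Nat.cast_add, hfst, hsnd, hone, ← htel,
    ← Finset.sum_add_distrib, ← Finset.sum_add_distrib]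
  refine Finset.sum_congr rfl fun p _ => ?_
  have h₁ : geomPoly (k - j) = X * geomPoly (k - (j + 1)) + 1 := by
    rw [← geomPoly_succ]; congr 1; omega
  have h₂ : X * (geomPoly (k - 1) * (runPoly k) ^ p) = (runPoly k) ^ (p + 1) := by
    rw [pow_succ', ← mul_assoc, runPoly]
  have h₃ : geomPoly k * (runPoly k) ^ p = (runPoly k) ^ (p + 1) + (runPoly k) ^ p := by
    rw [geomPoly_eq_runPoly_add_one hk]; ring
  rw [h₁, h₂, h₃, add_mul, one_mul, mul_assoc]
  simp only [coeff_add]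
  ring

theorem Nk_eq_sum {k : ℕ} (hk : 0 < k) {a b N : ℕ} (h : a + b < N) :
    (Nk k a b : ℤ) = ∑ p ∈ Finset.range N,
      (geomPoly k * (runPoly k) ^ p).coeff a * (geomPoly k * (runPoly k) ^ p).coeff b := by
  rw [Nk_eq_ncard, ncard_efficientExtensions_eq_sum hk N _ true 0 a b rfl h (Nat.zero_le k),
    Nat.sub_zero]

/-! ### Total positivity of order two -/

/-- The `2 × 2` minors of the Toeplitz matrix of the coefficients of `U` are nonnegative. -/
def IsTP2 (U : ℤ[X]) : Prop :=
  ∀ ⦃i j n l : ℕ⦄, i ≤ j → n ≤ l →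
    (X ^ j * U).coeff n * (X ^ i * U).coeff l ≤ (X ^ i * U).coeff n * (X ^ j * U).coeff l

theorem coeff_mul_eq_sum_range (T U : ℤ[X]) {N : ℕ} (hN : T.natDegree < N) (n : ℕ) :
    (T * U).coeff n = ∑ i ∈ Finset.range N, T.coeff i * (X ^ i * U).coeff n := by
  conv_lhs => rw [T.as_sum_range' N hN, Finset.sum_mul, finsetSum_coeff]
  refine Finset.sum_congr rfl fun i _ => ?_
  rw [← C_mul_X_pow_eq_monomial, mul_assoc, coeff_C_mul]

/-- A Cauchy–Binet inequality: if the coefficient ratio of `W` to `T` is nondecreasing and `U` is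
totally positive of order two, then the coefficient ratio of `W * U` to `T * U` is
nondecreasing. -/
theorem IsTP2.coeff_mul_le {U : ℤ[X]} (hU : IsTP2 U) {T W : ℤ[X]}
    (hTW : ∀ i j, i ≤ j → W.coeff i * T.coeff j ≤ T.coeff i * W.coeff j) {n l : ℕ} (hnl : n ≤ l) :
    (W * U).coeff n * (T * U).coeff l ≤ (T * U).coeff n * (W * U).coeff l := by
  set N := max T.natDegree W.natDegree + 1 with hN
  have hT : T.natDegree < N := by omega
  have hW : W.natDegree < N := by omega
  set u : ℕ → ℕ → ℤ := fun i n => (X ^ i * U).coeff n with hu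
  have key : 2 * ((T * U).coeff n * (W * U).coeff l - (W * U).coeff n * (T * U).coeff l)
      = ∑ i ∈ Finset.range N, ∑ j ∈ Finset.range N,
        (T.coeff i * W.coeff j - W.coeff i * T.coeff j) * (u i n * u j l - u j n * u i l) := by
    have h₁ : (T * U).coeff n * (W * U).coeff l = ∑ i ∈ Finset.range N, ∑ j ∈ Finset.range N,
        T.coeff i * W.coeff j * (u i n * u j l) := by
      rw [coeff_mul_eq_sum_range T U hT, coeff_mul_eq_sum_range W U hW, Finset.sum_mul_sum]
      exact Finset.sum_congr rfl fun i _ => Finset.sum_congr rfl fun j _ => by ring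
    have h₂ : (W * U).coeff n * (T * U).coeff l = ∑ i ∈ Finset.range N, ∑ j ∈ Finset.range N,
        W.coeff i * T.coeff j * (u i n * u j l) := by
      rw [coeff_mul_eq_sum_range T U hT, coeff_mul_eq_sum_range W U hW, Finset.sum_mul_sum]
      exact Finset.sum_congr rfl fun i _ => Finset.sum_congr rfl fun j _ => by ring
    rw [two_mul]
    nth_rewrite 2 [h₁, h₂]
    rw [Finset.sum_comm, Finset.sum_comm (f := fun i j => W.coeff i * T.coeff j * _), h₁, h₂]
    simp only [← Finset.sum_sub_distrib, ← Finset.sum_add_distrib]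
    exact Finset.sum_congr rfl fun i _ => Finset.sum_congr rfl fun j _ => by ring
  have hnonneg : 0 ≤ ∑ i ∈ Finset.range N, ∑ j ∈ Finset.range N,
      (T.coeff i * W.coeff j - W.coeff i * T.coeff j) * (u i n * u j l - u j n * u i l) := by
    refine Finset.sum_nonneg fun i _ => Finset.sum_nonneg fun j _ => ?_
    rcases le_total i j with h | h
    · exact mul_nonneg (sub_nonneg.2 (hTW i j h)) (sub_nonneg.2 (hU h hnl))
    · refine mul_nonneg_of_nonpos_of_nonpos ?_ (sub_nonpos.2 (hU h hnl))
      linarith [hTW j i h]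
  linarith

theorem isTP2_one : IsTP2 1 := by
  intro i j n l hij hnl
  simp only [mul_one, coeff_X_pow]
  split_ifs <;> omega

theorem IsTP2.mul {P U : ℤ[X]} (hP : IsTP2 P) (hU : IsTP2 U) : IsTP2 (P * U) := by
  intro i j n l hij hnl
  rw [← mul_assoc, ← mul_assoc]
  exact hU.coeff_mul_le (fun m m' hm => hP hij hm) hnl

theorem coeff_X_pow_mul_runPoly (k i n : ℕ) :
    (X ^ i * runPoly k).coeff n = if i + 1 ≤ n ∧ n < i + 1 + (k - 1) then 1 else 0 := by
  rw [runPoly, ← mul_assoc, ← pow_succ, coeff_X_pow_mul', coeff_geomPoly]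
  split_ifs <;> omega

theorem isTP2_runPoly (k : ℕ) : IsTP2 (runPoly k) := by
  intro i j n l hij hnl
  simp only [coeff_X_pow_mul_runPoly]
  split_ifs <;> omega

theorem isTP2_runPoly_pow (k p : ℕ) : IsTP2 ((runPoly k) ^ p) := by
  induction p with
  | zero => simpa using isTP2_one
  | succ p ih => rw [pow_succ]; exact ih.mul (isTP2_runPoly k)

/-! ### The inequality -/

theorem coeff_derivative_geomPoly (k i : ℕ) :
    (derivative (geomPoly k)).coeff i = if i + 1 < k then (i + 1 : ℤ) else 0 := by
  rw [coeff_derivative, coeff_geomPoly]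
  split_ifs <;> simp

theorem coeff_geomPoly_sq_nonneg (k i : ℕ) : 0 ≤ ((geomPoly k) ^ 2).coeff i := by
  rw [sq, coeff_mul]
  refine Finset.sum_nonneg fun x _ => ?_
  simp only [coeff_geomPoly]
  split_ifs <;> simp

theorem coeff_geomPoly_sq_of_lt {k i : ℕ} (h : i < k) : ((geomPoly k) ^ 2).coeff i = i + 1 := by
  rw [sq, coeff_mul, Finset.sum_congr rfl (g := fun _ => (1 : ℤ))]
  · simp
  · intro x hx
    rw [Finset.HasAntidiagonal.mem_antidiagonal] at hx
    simp only [coeff_geomPoly]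
    rw [if_pos (by omega), if_pos (by omega), one_mul]

theorem coeff_derivative_mul_coeff_sq_le (k : ℕ) {i j : ℕ} (hij : i ≤ j) :
    ((geomPoly k) ^ 2).coeff i * (derivative (geomPoly k)).coeff j
      ≤ (derivative (geomPoly k)).coeff i * ((geomPoly k) ^ 2).coeff j := by
  by_cases hj : j + 1 < k
  · rw [coeff_derivative_geomPoly, coeff_derivative_geomPoly, if_pos hj, if_pos (by omega),
      coeff_geomPoly_sq_of_lt (by omega), coeff_geomPoly_sq_of_lt (by omega)]
  · rw [coeff_derivative_geomPoly k j, if_neg hj, mul_zero, coeff_derivative_geomPoly]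
    refine mul_nonneg ?_ (coeff_geomPoly_sq_nonneg k j)
    split_ifs <;> positivity

theorem sum_coeff_derivative_mul_coeff {k : ℕ} (hk : 0 < k) {n l N : ℕ} (hl : l < N) :
    ∑ p ∈ Finset.range N, (derivative (geomPoly k * (runPoly k) ^ p)).coeff n
        * (geomPoly k * (runPoly k) ^ p).coeff l
      = ∑ p ∈ Finset.range N, (p + 1 : ℤ) * ((derivative (geomPoly k) * (runPoly k) ^ p).coeff n
        * ((geomPoly k) ^ 2 * (runPoly k) ^ p).coeff l) := by
  have hder : derivative (runPoly k) = derivative (geomPoly k) := by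
    simp [geomPoly_eq_runPoly_add_one hk]
  set A : ℕ → ℤ := fun p => (derivative (geomPoly k) * (runPoly k) ^ p).coeff n with hA
  set B : ℕ → ℤ := fun p => (geomPoly k * (runPoly k) ^ p).coeff l with hB
  have hD : ∀ p : ℕ, (derivative (geomPoly k * (runPoly k) ^ p)).coeff n
      = (p + 1) * A p + p * A (p - 1) := by
    intro p
    have : derivative (geomPoly k * (runPoly k) ^ p)
        = C (p + 1 : ℤ) * (derivative (geomPoly k) * (runPoly k) ^ p)
          + C (p : ℤ) * (derivative (geomPoly k) * (runPoly k) ^ (p - 1)) := by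
      rw [derivative_mul, derivative_pow, hder, geomPoly_eq_runPoly_add_one hk]
      rcases p with _ | p
      · simp
      · simp only [Nat.cast_add, Nat.cast_one, map_add, map_one, Nat.add_sub_cancel]
        ring
    rw [this, coeff_add, coeff_C_mul, coeff_C_mul]
  have hW : ∀ p : ℕ, ((geomPoly k) ^ 2 * (runPoly k) ^ p).coeff l = B p + B (p + 1) := by
    intro p
    have : (geomPoly k) ^ 2 * (runPoly k) ^ p
        = geomPoly k * (runPoly k) ^ p + geomPoly k * (runPoly k) ^ (p + 1) := by
      rw [geomPoly_eq_runPoly_add_one hk]; ring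
    rw [this, coeff_add]
  have hBN : B N = 0 := coeff_mul_runPoly_pow_of_lt _ hl
  have htel := Finset.sum_range_sub (fun p : ℕ => (p : ℤ) * A (p - 1) * B p) N
  rw [hBN] at htel
  rw [← sub_eq_zero, ← Finset.sum_sub_distrib, ← neg_eq_zero, ← Finset.sum_neg_distrib]
  refine Eq.trans (Finset.sum_congr rfl fun p _ => ?_) (htel.trans (by simp))
  rw [hD, hW]
  push_cast
  ring

end EfficientStrings

open EfficientStrings

/-- For `k ≥ 2` and `0 ≤ n < m`, `(n+1)·N_k(n+1, m-1) - m·N_k(n, m) ≥ 0`. -/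
theorem Nk_ratio_ineq (k n m : ℕ) (hk : 2 ≤ k) (hnm : n < m) :
    0 ≤ (n + 1 : ℤ) * (Nk k (n + 1) (m - 1) : ℤ) - (m : ℤ) * (Nk k n m : ℤ) := by
  obtain ⟨l, rfl⟩ : ∃ l, m = l + 1 := ⟨m - 1, by omega⟩
  have hk₀ : 0 < k := by omega
  have hfst : (n + 1 : ℤ) * (Nk k (n + 1) l : ℤ) = ∑ p ∈ Finset.range (n + l + 2),
      (derivative (geomPoly k * (runPoly k) ^ p)).coeff n
        * (geomPoly k * (runPoly k) ^ p).coeff l := by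
    rw [Nk_eq_sum hk₀ (by omega : n + 1 + l < n + l + 2), Finset.mul_sum]
    refine Finset.sum_congr rfl fun p _ => ?_
    rw [coeff_derivative]
    ring
  have hsnd : ((l + 1 : ℕ) : ℤ) * (Nk k n (l + 1) : ℤ) = ∑ p ∈ Finset.range (n + l + 2),
      (derivative (geomPoly k * (runPoly k) ^ p)).coeff l
        * (geomPoly k * (runPoly k) ^ p).coeff n := by
    rw [Nk_eq_sum hk₀ (by omega : n + (l + 1) < n + l + 2), Finset.mul_sum]
    refine Finset.sum_congr rfl fun p _ => ?_
    rw [coeff_derivative]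
    push_cast
    ring
  rw [Nat.add_sub_cancel, hfst, hsnd, sum_coeff_derivative_mul_coeff hk₀ (by omega),
    sum_coeff_derivative_mul_coeff hk₀ (by omega), sub_nonneg]
  refine Finset.sum_le_sum fun p _ => mul_le_mul_of_nonneg_left ?_ (by positivity)
  rw [mul_comm]
  exact (isTP2_runPoly_pow k p).coeff_mul_le
    (fun i j hij => coeff_derivative_mul_coeff_sq_le k hij) (by omega)
end
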